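/- The sequence of vectors n ↦ (c_2·c_4·⋯·c_{2n})^{−1} · (P_1·P_3·⋯·P_{2n−1}) e₂ converges in ℝ⁹, as n → ∞, to a nonzero vector. -/

import Mathlib

open Filter Finset Matrix

/-- The golden ratio φ = (1+√5)/2. -/
noncomputable def goldphi : ℝ := (1 + Real.sqrt 5) / 2

/-- The matrix `A`: identity in rows 1–7, row 8 = (0,0,0,0,0,1,1,1,1),
row 9 = (0,0,0,1,1,2,0,1,2). -/
def Amat : Matrix (Fin 9) (Fin 9) ℝ :=
  !![1,0,0,0,0,0,0,0,0;
     0,1,0,0,0,0,0,0,0;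
     0,0,1,0,0,0,0,0,0;
     0,0,0,1,0,0,0,0,0;
     0,0,0,0,1,0,0,0,0;
     0,0,0,0,0,1,0,0,0;
     0,0,0,0,0,0,1,0,0;
     0,0,0,0,0,1,1,1,1;
     0,0,0,1,1,2,0,1,2]

/-- The matrix `M` with rows e₆, e₉, e₈, e₂, e₄+e₅, e₇, e₁+e₃, e₃, e₄. -/
def Mmat : Matrix (Fin 9) (Fin 9) ℝ :=
  !![0,0,0,0,0,1,0,0,0;
     0,0,0,0,0,0,0,0,1;
     0,0,0,0,0,0,0,1,0;
     0,1,0,0,0,0,0,0,0;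
     0,0,0,1,1,0,0,0,0;
     0,0,0,0,0,0,1,0,0;
     1,0,1,0,0,0,0,0,0;
     0,0,1,0,0,0,0,0,0;
     0,0,0,1,0,0,0,0,0]

/-- The rank-one limit matrix `L`, nonzero only in rows 2 and 3. -/
noncomputable def Lmat : Matrix (Fin 9) (Fin 9) ℝ :=
  !![0,0,0,0,0,0,0,0,0;
     (Real.sqrt 5 - 1)/4, 1/2, (1 + Real.sqrt 5)/4, (3 + Real.sqrt 5)/4, 1/2, 0, (3 + Real.sqrt 5)/4, 0, 0;
     (3 - Real.sqrt 5)/4, (Real.sqrt 5 - 1)/4, 1/2, (1 + Real.sqrt 5)/4, (Real.sqrt 5 - 1)/4, 0, (1 + Real.sqrt 5)/4, 0, 0;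
     0,0,0,0,0,0,0,0,0;
     0,0,0,0,0,0,0,0,0;
     0,0,0,0,0,0,0,0,0;
     0,0,0,0,0,0,0,0,0;
     0,0,0,0,0,0,0,0,0;
     0,0,0,0,0,0,0,0,0]

/-- `a_i = r_i - 1`. -/
def aseq (r : ℕ → ℕ) (i : ℕ) : ℕ := r i - 1

/-- `c_i = (2/√5)·φ^{2 a_i}`. -/
noncomputable def cseq (r : ℕ → ℕ) (i : ℕ) : ℝ :=
  (2 / Real.sqrt 5) * goldphi ^ (2 * aseq r i)

/-- `P_i = A^{a_i} M A^{a_{i+1}} M`. -/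
noncomputable def Pmat (r : ℕ → ℕ) (i : ℕ) : Matrix (Fin 9) (Fin 9) ℝ :=
  Amat ^ (aseq r i) * Mmat * Amat ^ (aseq r (i+1)) * Mmat

/-- `R_i = P_i / c_{i+1}`. -/
noncomputable def Rmat (r : ℕ → ℕ) (i : ℕ) : Matrix (Fin 9) (Fin 9) ℝ :=
  (cseq r (i+1))⁻¹ • Pmat r i

/-- The Frobenius norm of a square real matrix. -/
noncomputable def frobNorm {n : ℕ} (X : Matrix (Fin n) (Fin n) ℝ) : ℝ :=
  Real.sqrt (∑ i, ∑ j, (X i j)^2)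

/-- The hypotheses on the sequence `r`: `r 1 = 1`, `r 2 = 2`, and the sequence of
differences `n ↦ r (n+1) - r n` (for `n ≥ 1`) is strictly increasing. -/
def GoodSeq (r : ℕ → ℕ) : Prop :=
  r 1 = 1 ∧ r 2 = 2 ∧ ∀ n, 1 ≤ n → r (n+1) - r n < r (n+2) - r (n+1)


/-- Perturbed products of an idempotent converge, close to the idempotent. -/
lemma perturbed_prod {R : Type*} [NormedRing R] [CompleteSpace R]
    (L : R) (hL : L * L = L) (E : ℕ → R) (hE : Summable fun n => ‖E n‖)
    (T : ℕ → R) (h0 : T 0 = 1) (hT : ∀ n, T (n+1) = T n * (L + E n)) :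
    ∃ X : R, Tendsto T atTop (nhds X) ∧
      ‖X - L‖ ≤ ((‖L‖ + ‖1 - L‖) * Real.exp ((‖L‖ + ‖1 - L‖) * ∑' n, ‖E n‖)) * ‖L‖
        * ∑' n, ‖E n‖ := by
  set K := ‖L‖ + ‖1 - L‖ with hK
  have hK0 : 0 ≤ K := by positivity
  set S := K * Real.exp (K * ∑' n, ‖E n‖) with hS
  have hLL : L * (1 - L) = 0 := by rw [mul_sub, hL, mul_one, sub_self]
  have hp : ∀ n, T (n+1) * L = T n * L + T n * E n * L := by
    intro n
    rw [hT, mul_assoc, add_mul, hL, mul_add, mul_assoc]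
  have hq : ∀ n, T (n+1) * (1 - L) = T n * E n * (1 - L) := by
    intro n
    rw [hT, mul_assoc, add_mul, hLL, zero_add, mul_assoc]
  have hTs : ∀ n, ‖T n‖ ≤ ‖T n * L‖ + ‖T n * (1 - L)‖ := by
    intro n
    have : T n = T n * L + T n * (1 - L) := by rw [← mul_add]; simp
    calc ‖T n‖ = ‖T n * L + T n * (1 - L)‖ := by rw [← this]
      _ ≤ _ := norm_add_le _ _
  have hTE : ∀ n (Y : R), ‖T n * E n * Y‖ ≤ ‖T n‖ * ‖E n‖ * ‖Y‖ := fun n Y =>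
    (norm_mul_le _ _).trans (mul_le_mul_of_nonneg_right (norm_mul_le _ _) (norm_nonneg _))
  have hs : ∀ n, ‖T n * L‖ + ‖T n * (1 - L)‖
      ≤ K * Real.exp (K * ∑ k ∈ Finset.range n, ‖E k‖) := by
    intro n
    induction n with
    | zero => simp [h0, hK]
    | succ n ih =>
      rw [hp, hq, Finset.sum_range_succ, mul_add, Real.exp_add, ← mul_assoc]
      have h1 := hTE n L
      have h2 := hTE n (1 - L)
      have h3 := norm_add_le (T n * L) (T n * E n * L)
      have h4 := hTs n
      have h5 : K * ‖E n‖ + 1 ≤ Real.exp (K * ‖E n‖) := Real.add_one_le_exp _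
      have h6 : 0 ≤ K * ‖E n‖ := by positivity
      set s := ‖T n * L‖ + ‖T n * (1 - L)‖ with hsdef
      have h7 : ‖T n * L‖ ≤ s := by rw [hsdef]; linarith [norm_nonneg (T n * (1 - L))]
      have h8 : ‖T n‖ * (K * ‖E n‖) ≤ s * (K * ‖E n‖) := mul_le_mul_of_nonneg_right h4 h6
      calc _ ≤ s * (K * ‖E n‖ + 1) := by
            have : ‖T n‖ * (K * ‖E n‖) = ‖T n‖ * ‖E n‖ * ‖L‖ + ‖T n‖ * ‖E n‖ * ‖1 - L‖ := by
              rw [hK]; ring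
            linarith
        _ ≤ _ := mul_le_mul ih h5 (by positivity) (by positivity)
  have hb : ∀ n, ‖T n‖ ≤ S := by
    intro n
    refine (hTs n).trans ((hs n).trans ?_)
    refine mul_le_mul_of_nonneg_left (Real.exp_le_exp.2 ?_) hK0
    exact mul_le_mul_of_nonneg_left (hE.sum_le_tsum _ (fun _ _ => norm_nonneg _)) hK0
  have hS0 : 0 ≤ S := by positivity
  have hd : ∀ n, dist (T n * L) (T (n+1) * L) ≤ S * ‖L‖ * ‖E n‖ := by
    intro n
    rw [dist_comm, dist_eq_norm, hp, add_sub_cancel_left]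
    refine (hTE n L).trans ?_
    have := mul_le_mul_of_nonneg_right (hb n) (by positivity : 0 ≤ ‖E n‖ * ‖L‖)
    nlinarith
  have hsum : Summable fun n => S * ‖L‖ * ‖E n‖ := hE.mul_left _
  obtain ⟨X, hX⟩ := cauchySeq_tendsto_of_complete (cauchySeq_of_dist_le_of_summable _ hd hsum)
  refine ⟨X, ?_, ?_⟩
  · have hq0 : Tendsto (fun n => T (n+1) * (1 - L)) atTop (nhds 0) := by
      apply squeeze_zero_norm (a := fun n => S * ‖1 - L‖ * ‖E n‖)
      · intro n
        rw [hq]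
        refine (hTE n _).trans ?_
        have := mul_le_mul_of_nonneg_right (hb n) (by positivity : 0 ≤ ‖E n‖ * ‖1 - L‖)
        nlinarith
      · simpa using hE.tendsto_atTop_zero.const_mul (S * ‖1 - L‖)
    have hX1 := (tendsto_add_atTop_iff_nat 1).2 hX
    have := hX1.add hq0
    rw [add_zero] at this
    rw [← tendsto_add_atTop_iff_nat 1]
    refine this.congr fun n => ?_
    rw [← mul_add]; simp
  · have := dist_le_tsum_of_dist_le_of_tendsto₀ _ hd hsum hX
    rw [dist_comm, dist_eq_norm, h0, one_mul, tsum_mul_left] at this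
    exact this

/-- Rank-one matrices attached to an eigenvalue `x ^ 2` of `A`, where `x ^ 2 = x + 1`. -/
def gmat (x : ℝ) : Matrix (Fin 9) (Fin 9) ℝ :=
  Matrix.vecMulVec ![0,0,0,0,0,0,0,1,x] ![0,0,0,1,1,x+1,x-1,1,x]

lemma A_mul_gmat (x : ℝ) (hx : x ^ 2 = x + 1) : Amat * gmat x = x ^ 2 • gmat x := by
  rw [gmat, Matrix.mul_vecMulVec, ← Matrix.smul_vecMulVec]
  congr 1
  ext i
  fin_cases i <;> simp [Amat, Matrix.mulVec, dotProduct, Fin.sum_univ_succ] <;> grind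

lemma A_sub_one (x : ℝ) :
    (2 * x - 1) • (Amat - 1) = gmat x - gmat (1 - x) := by
  have h1 : Amat - 1 = Matrix.of ![0,0,0,0,0,0,0,![0,0,0,0,0,1,1,0,1],![0,0,0,1,1,2,0,1,1]] := by
    rw [sub_eq_iff_eq_add]
    ext i j
    rw [Matrix.add_apply, Matrix.one_apply]
    fin_cases i <;> fin_cases j <;> simp [Amat] <;> norm_num
  rw [h1, gmat, gmat]
  ext i j
  rw [Matrix.smul_apply, Matrix.sub_apply, Matrix.vecMulVec_apply, Matrix.vecMulVec_apply]
  fin_cases i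
  · simp
  · simp
  · simp
  · simp
  · simp
  · simp
  · simp
  · fin_cases j <;> simp <;> ring
  · fin_cases j <;> simp <;> ring

lemma M_g_M : Mmat * gmat goldphi * Mmat = (2 * goldphi) • Lmat := by
  have h : Real.sqrt 5 ^ 2 = 5 := Real.sq_sqrt (by norm_num)
  have h1 : Mmat *ᵥ ![0,0,0,0,0,0,0,1,goldphi] = ![0,goldphi,1,0,0,0,0,0,0] := by
    ext i
    fin_cases i <;> simp [Mmat, Matrix.mulVec, dotProduct, Fin.sum_univ_succ]
  have h2 : ![0,0,0,1,1,goldphi+1,goldphi-1,1,goldphi] ᵥ* Mmat =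
      ![goldphi-1,1,goldphi,goldphi+1,1,0,goldphi+1,0,0] := by
    ext i
    fin_cases i <;> simp [Mmat, Matrix.vecMul, dotProduct, Fin.sum_univ_succ] <;> ring
  rw [gmat, Matrix.mul_vecMulVec, Matrix.vecMulVec_mul, h1, h2, Lmat, goldphi]
  generalize Real.sqrt 5 = s at *
  ext i j
  fin_cases i <;> fin_cases j <;> simp [Matrix.vecMulVec_apply] <;> linarith

lemma A_M_g (x : ℝ) : Amat * (Mmat * gmat x) = Mmat * gmat x := by
  rw [gmat, Matrix.mul_vecMulVec, Matrix.mul_vecMulVec]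
  congr 1
  ext i
  fin_cases i <;> simp [Amat, Mmat, Matrix.mulVec, dotProduct, Fin.sum_univ_succ]

lemma L_idem : Lmat * Lmat = Lmat := by
  have h : Real.sqrt 5 ^ 2 = 5 := Real.sq_sqrt (by norm_num)
  rw [Lmat]
  generalize Real.sqrt 5 = s at *
  ext i j
  fin_cases i <;> fin_cases j <;>
    simp [Matrix.mul_apply, Fin.sum_univ_succ] <;> linarith

lemma A_inj (v : Fin 9 → ℝ) (h : Amat.mulVec v = 0) : v = 0 := by
  have h0 := fun i => congrFun h i
  simp [Amat, Matrix.mulVec, dotProduct, Fin.sum_univ_succ, Fin.forall_fin_succ] at h0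
  ext i
  fin_cases i <;> simp <;> grind

lemma M_inj (v : Fin 9 → ℝ) (h : Mmat.mulVec v = 0) : v = 0 := by
  have h0 := fun i => congrFun h i
  simp [Mmat, Matrix.mulVec, dotProduct, Fin.sum_univ_succ, Fin.forall_fin_succ] at h0
  ext i
  fin_cases i <;> simp <;> grind

lemma goldphi_sq : goldphi ^ 2 = goldphi + 1 := by
  have h : Real.sqrt 5 ^ 2 = 5 := Real.sq_sqrt (by norm_num)
  rw [goldphi]; linarith

lemma sqrt5_eq : Real.sqrt 5 = 2 * goldphi - 1 := by rw [goldphi]; ring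

lemma one_lt_goldphi : 1 < goldphi := by
  have : 1 < Real.sqrt 5 := by rw [Real.lt_sqrt] <;> norm_num
  rw [goldphi]; linarith

/-- The eigenvalue-one part of `A`. -/
noncomputable def Dmat : Matrix (Fin 9) (Fin 9) ℝ :=
  1 - (goldphi * Real.sqrt 5)⁻¹ • gmat goldphi
    + ((1 - goldphi) * Real.sqrt 5)⁻¹ • gmat (1 - goldphi)

lemma A_mul_D : Amat * Dmat = Dmat := by
  have h1 := A_sub_one goldphi
  have hφ := one_lt_goldphi
  have hs : (0:ℝ) < 2 * goldphi - 1 := by linarith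
  have hψ : (1 - goldphi) ≠ 0 := by linarith
  have hφ0 : goldphi ≠ 0 := by linarith
  have h2 := A_mul_gmat goldphi goldphi_sq
  have h3 := A_mul_gmat (1 - goldphi) (by linarith [goldphi_sq])
  have hA : Amat = 1 + (2 * goldphi - 1)⁻¹ • (gmat goldphi - gmat (1 - goldphi)) := by
    rw [← h1, smul_smul, inv_mul_cancel₀ hs.ne', one_smul]; abel
  rw [Dmat, mul_add, mul_sub, mul_one, mul_smul_comm, mul_smul_comm, h2, h3, sqrt5_eq]
  nth_rewrite 1 [hA]
  have e1 : goldphi ^ 2 = goldphi + 1 := goldphi_sq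
  have e2 : (1 - goldphi) ^ 2 = (1 - goldphi) + 1 := by linarith
  rw [e1, e2]
  have hs' := hs.ne'
  generalize gmat goldphi = X
  generalize gmat (1 - goldphi) = Y
  match_scalars <;> field_simp <;> ring

lemma A_pow (n : ℕ) : Amat ^ n = (goldphi ^ 2) ^ n • (goldphi * Real.sqrt 5)⁻¹ • gmat goldphi
    + (Dmat - ((1 - goldphi) ^ 2) ^ n • ((1 - goldphi) * Real.sqrt 5)⁻¹ • gmat (1 - goldphi)) := by
  induction n with
  | zero => simp [Dmat]
  | succ n ih =>
    rw [pow_succ', ih, mul_add, mul_sub, A_mul_D]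
    simp only [mul_smul_comm]
    rw [A_mul_gmat goldphi goldphi_sq, A_mul_gmat (1 - goldphi) (by linarith [goldphi_sq])]
    match_scalars <;> ring

lemma A_pow_M_g (n : ℕ) (x : ℝ) : Amat ^ n * (Mmat * gmat x) = Mmat * gmat x := by
  induction n with
  | zero => simp
  | succ n ih => rw [pow_succ, mul_assoc, A_M_g, ih]

section
attribute [local instance] Matrix.linftyOpNormedRing Matrix.linftyOpNormedAlgebra

/-- The bounded part of the powers of `A`. -/
noncomputable def Cmat (n : ℕ) : Matrix (Fin 9) (Fin 9) ℝ :=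
  Dmat - ((1 - goldphi) ^ 2) ^ n • ((1 - goldphi) * Real.sqrt 5)⁻¹ • gmat (1 - goldphi)

lemma C_bdd : ∃ K : ℝ, 0 ≤ K ∧ ∀ n, ‖Cmat n‖ ≤ K := by
  refine ⟨‖Dmat‖ + ‖((1 - goldphi) * Real.sqrt 5)⁻¹ • gmat (1 - goldphi)‖, by positivity, ?_⟩
  intro n
  refine (norm_sub_le _ _).trans ?_
  gcongr
  rw [norm_smul]
  refine mul_le_of_le_one_left (norm_nonneg _) ?_
  rw [Real.norm_of_nonneg (by positivity)]
  apply pow_le_one₀ (by positivity)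
  nlinarith [one_lt_goldphi, goldphi_sq]

lemma A_bdd : ∃ K : ℝ, 0 ≤ K ∧ ∀ n, ‖Amat ^ n‖ ≤ K * (goldphi ^ 2) ^ n := by
  obtain ⟨K, hK, hC⟩ := C_bdd
  refine ⟨‖(goldphi * Real.sqrt 5)⁻¹ • gmat goldphi‖ + K, by positivity, ?_⟩
  intro n
  have h1 : 1 ≤ (goldphi ^ 2) ^ n := one_le_pow₀ (one_le_pow₀ one_lt_goldphi.le)
  rw [A_pow n]
  refine (norm_add_le _ _).trans ?_
  have := hC n
  rw [Cmat] at this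
  rw [norm_smul _ ((goldphi * Real.sqrt 5)⁻¹ • gmat goldphi), Real.norm_of_nonneg (by positivity)]
  nlinarith

lemma R_sub_L (r : ℕ → ℕ) (i : ℕ) : Rmat r i - Lmat =
    (cseq r (i+1))⁻¹ • (Amat ^ (aseq r i) * Mmat * Cmat (aseq r (i+1)) * Mmat) := by
  have hφ := one_lt_goldphi
  have hs : 0 < Real.sqrt 5 := by positivity
  have hφ0 : goldphi ≠ 0 := by linarith
  rw [Rmat, Pmat, A_pow (aseq r (i+1)), ← Cmat, mul_add, add_mul, smul_add, sub_eq_iff_eq_add,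
    add_comm]
  congr 1
  simp only [mul_smul_comm, smul_mul_assoc]
  rw [mul_assoc (Amat ^ _), A_pow_M_g, M_g_M, smul_smul, smul_smul, smul_smul]
  convert one_smul ℝ Lmat
  rw [cseq, pow_mul]
  field_simp

lemma aseq_growth (r : ℕ → ℕ) (hr : GoodSeq r) (i : ℕ) :
    aseq r (i+1) + (i + 1) ≤ aseq r (i+2) := by
  obtain ⟨h1, h2, h3⟩ := hr
  have hd : ∀ n, n + 1 ≤ r (n+2) - r (n+1) := by
    intro n
    induction n with
    | zero => simp [h1, h2]
    | succ n ih =>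
      have h4 : r (n+2) - r (n+1) < r (n+3) - r (n+2) := h3 (n+1) (by omega)
      change n + 1 + 1 ≤ r (n+3) - r (n+2)
      omega
  have hpos : ∀ n, 1 ≤ r (n+1) := by
    intro n
    induction n with
    | zero => simp [h1]
    | succ n ih =>
      have h4 := hd n
      change 1 ≤ r (n+2)
      omega
  have := hd i
  have := hpos i
  simp only [aseq]
  omega

lemma E_summable (r : ℕ → ℕ) (hr : GoodSeq r) :
    Summable fun l => ‖Rmat r (2*l+1) - Lmat‖ := by
  obtain ⟨K, hK, hC⟩ := C_bdd
  obtain ⟨K', hK', hA⟩ := A_bdd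
  have hφ := one_lt_goldphi
  have hφ0 : 0 < goldphi := by linarith
  have hφ2 : 1 < goldphi ^ 2 := one_lt_pow₀ hφ (by norm_num)
  have hg : Summable fun l : ℕ => (Real.sqrt 5 / 2 * K' * ‖Mmat‖ * K * ‖Mmat‖)
      * ((goldphi ^ 2)⁻¹) ^ l :=
    (summable_geometric_of_lt_one (by positivity) (inv_lt_one_of_one_lt₀ hφ2)).mul_left _
  refine Summable.of_nonneg_of_le (fun _ => norm_nonneg _) (fun l => ?_) hg
  rw [R_sub_L, norm_smul]
  have hgr := aseq_growth r hr (2*l)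
  set a := aseq r (2*l+1)
  have e : 2 * l + 1 + 1 = 2 * l + 2 := rfl
  rw [e]
  set b := aseq r (2*l+2) with hb
  have hn : ‖Amat ^ a * Mmat * Cmat b * Mmat‖ ≤ K' * (goldphi ^ 2) ^ a * ‖Mmat‖ * K * ‖Mmat‖ := by
    calc _ ≤ ‖Amat ^ a‖ * ‖Mmat‖ * ‖Cmat b‖ * ‖Mmat‖ := by
          refine (norm_mul_le _ _).trans ?_
          gcongr
          refine (norm_mul_le _ _).trans ?_
          gcongr
          exact norm_mul_le _ _
      _ ≤ _ := by
          gcongr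
          · exact hA a
          · exact hC b
  have hc : ‖(cseq r (2*l+2))⁻¹‖ = Real.sqrt 5 / 2 * ((goldphi ^ 2) ^ b)⁻¹ := by
    rw [cseq, ← hb, pow_mul, Real.norm_of_nonneg (by positivity), mul_inv, inv_div]
  rw [hc]
  have hab : (goldphi ^ 2) ^ a * ((goldphi ^ 2) ^ b)⁻¹ ≤ ((goldphi ^ 2)⁻¹) ^ l := by
    rw [inv_pow, ← div_eq_mul_inv, div_le_iff₀ (by positivity), inv_mul_eq_div,
      le_div_iff₀ (by positivity), ← pow_add]
    exact pow_le_pow_right₀ hφ2.le (by omega)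
  calc _ ≤ Real.sqrt 5 / 2 * ((goldphi ^ 2) ^ b)⁻¹ *
        (K' * (goldphi ^ 2) ^ a * ‖Mmat‖ * K * ‖Mmat‖) := by gcongr
    _ = (Real.sqrt 5 / 2 * K' * ‖Mmat‖ * K * ‖Mmat‖) *
        ((goldphi ^ 2) ^ a * ((goldphi ^ 2) ^ b)⁻¹) := by ring
    _ ≤ _ := by gcongr

/-- Products of the matrices `R` starting at `N`. -/
noncomputable def Tprod (r : ℕ → ℕ) (N n : ℕ) : Matrix (Fin 9) (Fin 9) ℝ :=
  ((List.range n).map (fun l => Rmat r (2*(l+N)+1))).prod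

lemma Tprod_succ (r : ℕ → ℕ) (N n : ℕ) :
    Tprod r N (n+1) = Tprod r N n * Rmat r (2*(n+N)+1) := by
  simp [Tprod, List.range_succ]

lemma Tprod_add (r : ℕ → ℕ) (N n : ℕ) :
    Tprod r 0 (n+N) = Tprod r 0 N * Tprod r N n := by
  induction n with
  | zero => simp [Tprod]
  | succ n ih => rw [Nat.add_right_comm, Tprod_succ, ih, Tprod_succ, mul_assoc]; rfl

lemma Tprod_eq (r : ℕ → ℕ) (n : ℕ) : Tprod r 0 n = (∏ l ∈ Finset.range n, cseq r (2*l+2))⁻¹ •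
    ((List.range n).map (fun l => Pmat r (2*l+1))).prod := by
  induction n with
  | zero => simp [Tprod]
  | succ n ih =>
    rw [Tprod_succ, ih, Finset.prod_range_succ, List.range_succ, Rmat]
    simp [mul_inv, smul_smul, mul_comm]

lemma R_inj (r : ℕ → ℕ) (i : ℕ) (v : Fin 9 → ℝ) (h : Rmat r i *ᵥ v = 0) : v = 0 := by
  have hpow : ∀ n (w : Fin 9 → ℝ), Amat ^ n *ᵥ w = 0 → w = 0 := by
    intro n
    induction n with
    | zero => simp
    | succ n ih =>
      intro w hw
      rw [pow_succ, ← Matrix.mulVec_mulVec] at hw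
      exact A_inj _ (ih _ hw)
  have hc : (cseq r (i+1))⁻¹ ≠ 0 := by
    have := one_lt_goldphi
    have : 0 < goldphi := by linarith
    rw [cseq]; positivity
  rw [Rmat, Matrix.smul_mulVec, smul_eq_zero] at h
  have h := h.resolve_left hc
  rw [Pmat, ← Matrix.mulVec_mulVec, ← Matrix.mulVec_mulVec, ← Matrix.mulVec_mulVec] at h
  exact M_inj _ (hpow _ _ (M_inj _ (hpow _ _ h)))

lemma Tprod_inj (r : ℕ → ℕ) (N n : ℕ) (v : Fin 9 → ℝ) (h : Tprod r N n *ᵥ v = 0) : v = 0 := by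
  induction n generalizing v with
  | zero => simpa [Tprod] using h
  | succ n ih =>
    rw [Tprod_succ, ← Matrix.mulVec_mulVec] at h
    exact R_inj _ _ _ (ih _ h)

lemma Tprod_lim (r : ℕ → ℕ) (hr : GoodSeq r) :
    ∃ (N : ℕ) (X : Matrix (Fin 9) (Fin 9) ℝ), Tendsto (Tprod r N) atTop (nhds X) ∧
      X *ᵥ (Pi.single (1 : Fin 9) (1 : ℝ)) ≠ 0 := by
  have hE := E_summable r hr
  have key := fun N => perturbed_prod Lmat L_idem (fun n => Rmat r (2*(n+N)+1) - Lmat)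
    ((summable_nat_add_iff N).2 hE) (Tprod r N) (by simp [Tprod])
    (fun n => by rw [Tprod_succ]; congr 1; abel)
  choose X hX hXL using key
  have htail := tendsto_sum_nat_add fun l => ‖Rmat r (2*l+1) - Lmat‖
  have hlim : Tendsto X atTop (nhds Lmat) := by
    refine tendsto_iff_norm_sub_tendsto_zero.2 ?_
    refine squeeze_zero (fun _ => norm_nonneg _) hXL ?_
    have h1 := (htail.const_mul (‖Lmat‖ + ‖1 - Lmat‖)).rexp.const_mul (‖Lmat‖ + ‖1 - Lmat‖)
    have h2 := (h1.mul_const ‖Lmat‖).mul htail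
    simpa using h2
  have hent : Tendsto (fun N => X N 1 1) atTop (nhds (Lmat 1 1)) :=
    ((continuous_apply_apply (1 : Fin 9) (1 : Fin 9)).tendsto Lmat).comp hlim
  have hL : Lmat 1 1 = 1/2 := by simp [Lmat]
  rw [hL] at hent
  obtain ⟨N, hN⟩ := (hent.eventually (lt_mem_nhds (by norm_num : (0:ℝ) < 1/2))).exists
  refine ⟨N, X N, hX N, fun h => ?_⟩
  have := congrFun h 1
  simp at this
  linarith
end

/-- `(c_2 c_4 ⋯ c_{2n})⁻¹ (P_1 P_3 ⋯ P_{2n−1}) e₂` converges to a nonzero vector. -/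
theorem stmt8 (r : ℕ → ℕ) (hr : GoodSeq r) :
    ∃ v : Fin 9 → ℝ, v ≠ 0 ∧
      Tendsto
        (fun n => (∏ l ∈ Finset.range n, cseq r (2*l+2))⁻¹ •
          (((List.range n).map (fun l => Pmat r (2*l+1))).prod).mulVec
            (Pi.single (1 : Fin 9) (1 : ℝ)))
        atTop (nhds v) := by
  obtain ⟨N, X, hX, hne⟩ := Tprod_lim r hr
  refine ⟨Tprod r 0 N *ᵥ (X *ᵥ (Pi.single (1 : Fin 9) (1 : ℝ))),
    fun h => hne (Tprod_inj _ _ _ _ h), ?_⟩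
  rw [← tendsto_add_atTop_iff_nat N]
  have hcont : Continuous fun Y : Matrix (Fin 9) (Fin 9) ℝ =>
      Tprod r 0 N *ᵥ (Y *ᵥ (Pi.single (1 : Fin 9) (1 : ℝ))) := by fun_prop
  refine ((hcont.tendsto X).comp hX).congr fun n => ?_
  rw [← Matrix.smul_mulVec, ← Tprod_eq, Tprod_add, ← Matrix.mulVec_mulVec]
  rfl
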